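/- arXiv:2512.22040 — 7 statements merged into one kernel-verified Lean document; each statement's English description precedes it below -/
import Mathlib

section
/- Let ξ and η be real numbers with ξη > 0 (nonzero and of the same sign). Then the product of the four three-wave resonance factors satisfies (|ξ|^{5/2} + |η|^{5/2} + |ξ+η|^{5/2}) · (|ξ|^{5/2} + |η|^{5/2} − |ξ+η|^{5/2}) · (|ξ|^{5/2} − |η|^{5/2} + |ξ+η|^{5/2}) · (|ξ|^{5/2} − |η|^{5/2} − |ξ+η|^{5/2}) = ξ^2 η^2 · D(ξ,η), where D(ξ,η) = 25ξ^6 + 100ξ^5η + 200ξ^4η^2 + 246ξ^3η^3 + 200ξ^2η^4 + 100ξη^5 + 25η^6, and here x^{5/2} denotes the real power x^{5/2} of x ≥ 0. -/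
theorem abs_rpow_five_halves_sq (x : ℝ) : (|x| ^ ((5 : ℝ) / 2)) ^ 2 = |x| ^ 5 := by
  rw [← Real.rpow_natCast, ← Real.rpow_mul (abs_nonneg x), ← Real.rpow_natCast]
  norm_num

theorem four_factor_product_eq {R : Type*} [CommRing R] (a b c : R) :
    (a + b + c) * (a + b - c) * (a - b + c) * (a - b - c)
      = (c ^ 2 - a ^ 2 - b ^ 2) ^ 2 - 4 * a ^ 2 * b ^ 2 := by
  ring

/-- For frequencies `ξ, η` of the same sign, the product of the four three-wave resonance
factors `|ξ|^(5/2) ± |η|^(5/2) ± |ξ+η|^(5/2)` equals `ξ²η²·D(ξ,η)`, where `D` is the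
three-wave resonance polynomial of the hydroelastic dispersion relation. -/
theorem resonance_product_eq (ξ η : ℝ) (h : ξ * η > 0) :
    (|ξ| ^ ((5 : ℝ) / 2) + |η| ^ ((5 : ℝ) / 2) + |ξ + η| ^ ((5 : ℝ) / 2)) *
      (|ξ| ^ ((5 : ℝ) / 2) + |η| ^ ((5 : ℝ) / 2) - |ξ + η| ^ ((5 : ℝ) / 2)) *
      (|ξ| ^ ((5 : ℝ) / 2) - |η| ^ ((5 : ℝ) / 2) + |ξ + η| ^ ((5 : ℝ) / 2)) *
      (|ξ| ^ ((5 : ℝ) / 2) - |η| ^ ((5 : ℝ) / 2) - |ξ + η| ^ ((5 : ℝ) / 2))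
    = ξ ^ 2 * η ^ 2 *
        (25 * ξ ^ 6 + 100 * ξ ^ 5 * η + 200 * ξ ^ 4 * η ^ 2 + 246 * ξ ^ 3 * η ^ 3
          + 200 * ξ ^ 2 * η ^ 4 + 100 * ξ * η ^ 5 + 25 * η ^ 6) := by
  rw [four_factor_product_eq]
  simp only [abs_rpow_five_halves_sq]
  rcases mul_pos_iff.mp h with ⟨hξ, hη⟩ | ⟨hξ, hη⟩
  · rw [abs_of_pos hξ, abs_of_pos hη, abs_of_pos (add_pos hξ hη)]
    ring
  · rw [abs_of_neg hξ, abs_of_neg hη, abs_of_neg (add_neg hξ hη)]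
    ring
end

section
/- For all real numbers ξ and η with (ξ,η) ≠ (0,0), the three-wave resonance polynomial is strictly positive: D(ξ,η) = 25ξ^6 + 100ξ^5η + 200ξ^4η^2 + 246ξ^3η^3 + 200ξ^2η^4 + 100ξη^5 + 25η^6 > 0. In particular D(ξ,η) = 0 if and only if ξ = η = 0. -/
/-- The three-wave resonance polynomial `D(ξ,η)` of the hydroelastic dispersion relation. -/
noncomputable def resonancePoly (ξ η : ℝ) : ℝ :=
  25 * ξ ^ 6 + 100 * ξ ^ 5 * η + 200 * ξ ^ 4 * η ^ 2 + 246 * ξ ^ 3 * η ^ 3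
    + 200 * ξ ^ 2 * η ^ 4 + 100 * ξ * η ^ 5 + 25 * η ^ 6

/-- The resonance polynomial in terms of the sum and the product of its arguments. -/
theorem resonancePoly_eq (ξ η : ℝ) :
    resonancePoly ξ η =
      25 * (ξ + η) ^ 2 * ((ξ + η) ^ 2 - ξ * η) ^ 2 - 4 * (ξ * η) ^ 3 := by
  unfold resonancePoly
  ring

/-- The resonance polynomial in terms of the difference and the product of its arguments. -/
theorem resonancePoly_eq_sub (ξ η : ℝ) :
    resonancePoly ξ η =
      25 * ((ξ - η) ^ 2) ^ 3 + 250 * ((ξ - η) ^ 2) ^ 2 * (ξ * η)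
        + 825 * (ξ - η) ^ 2 * (ξ * η) ^ 2 + 896 * (ξ * η) ^ 3 := by
  unfold resonancePoly
  ring

/-- The three-wave resonance polynomial is strictly positive away from the origin;
in particular it vanishes exactly at the origin. -/
theorem resonancePoly_pos :
    (∀ ξ η : ℝ, (ξ, η) ≠ (0, 0) → 0 < resonancePoly ξ η) ∧
      (∀ ξ η : ℝ, resonancePoly ξ η = 0 ↔ ξ = 0 ∧ η = 0) := by
  have pos : ∀ ξ η : ℝ, (ξ, η) ≠ (0, 0) → 0 < resonancePoly ξ η := by
    intro ξ η h
    rcases lt_trichotomy (ξ * η) 0 with hb | hb | hb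
    · rw [resonancePoly_eq]
      have hcube : (ξ * η) ^ 3 < 0 := Odd.pow_neg (by decide) hb
      have hsq : 0 ≤ 25 * (ξ + η) ^ 2 * ((ξ + η) ^ 2 - ξ * η) ^ 2 := by positivity
      linarith
    · rcases mul_eq_zero.mp hb with rfl | rfl
      · have hη : η ≠ 0 := by simpa using h
        simp only [resonancePoly_eq_sub]
        ring_nf
        positivity
      · have hξ : ξ ≠ 0 := by simpa using h
        simp only [resonancePoly_eq_sub]
        ring_nf
        positivity
    · rw [resonancePoly_eq_sub]
      generalize ξ * η = b at hb
      positivity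
  refine ⟨pos, fun ξ η => ⟨fun h => ?_, ?_⟩⟩
  · by_contra hne
    exact (pos ξ η (by simpa using hne)).ne' h
  · rintro ⟨rfl, rfl⟩
    simp [resonancePoly]
end

section
/- Absence of three-wave resonances: let ξ and η be real numbers with ξη > 0 (nonzero and of the same sign). Then for every choice of signs ε₁, ε₂ ∈ {+1, −1}, one has |ξ|^{5/2} + ε₁|η|^{5/2} + ε₂|ξ+η|^{5/2} ≠ 0, where x^{5/2} denotes the real power of x ≥ 0. -/
/-- Strict superadditivity of `x ↦ x ^ p` on the positive reals for `1 < p`. -/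
theorem Real.rpow_add_rpow_lt_add_rpow {x y p : ℝ} (hx : 0 < x) (hy : 0 < y) (hp : 1 < p) :
    x ^ p + y ^ p < (x + y) ^ p := by
  have hsplit : ∀ z : ℝ, 0 < z → z ^ p = z * z ^ (p - 1) := fun z hz => by
    rw [← Real.rpow_one_add' hz.le (by linarith), add_sub_cancel]
  have hxs : x ^ (p - 1) < (x + y) ^ (p - 1) :=
    Real.rpow_lt_rpow hx.le (by linarith) (by linarith)
  have hys : y ^ (p - 1) < (x + y) ^ (p - 1) :=
    Real.rpow_lt_rpow hy.le (by linarith) (by linarith)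
  rw [hsplit x hx, hsplit y hy, hsplit (x + y) (by linarith), add_mul]
  exact add_lt_add (mul_lt_mul_of_pos_left hxs hx) (mul_lt_mul_of_pos_left hys hy)

/-- Absence of three-wave resonances for the hydroelastic dispersion relation
`τ = ±|ξ|^(5/2)`: for nonzero frequencies `ξ, η` of the same sign and any choice of signs,
`|ξ|^(5/2) + ε₁|η|^(5/2) + ε₂|ξ+η|^(5/2) ≠ 0`. -/
theorem no_three_wave_resonance (ξ η : ℝ) (h : ξ * η > 0)
    (ε₁ ε₂ : ℝ) (hε₁ : ε₁ = 1 ∨ ε₁ = -1) (hε₂ : ε₂ = 1 ∨ ε₂ = -1) :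
    |ξ| ^ ((5 : ℝ) / 2) + ε₁ * |η| ^ ((5 : ℝ) / 2) + ε₂ * |ξ + η| ^ ((5 : ℝ) / 2) ≠ 0 := by
  have hξ : 0 < |ξ| := abs_pos.mpr (left_ne_zero_of_mul h.ne')
  have hη : 0 < |η| := abs_pos.mpr (right_ne_zero_of_mul h.ne')
  have habs : |ξ + η| = |ξ| + |η| := by
    rw [abs_add_eq_add_abs_iff]
    rcases mul_pos_iff.mp h with ⟨h₁, h₂⟩ | ⟨h₁, h₂⟩
    · exact Or.inl ⟨h₁.le, h₂.le⟩
    · exact Or.inr ⟨h₁.le, h₂.le⟩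
  have hlt := Real.rpow_add_rpow_lt_add_rpow hξ hη (p := 5 / 2) (by norm_num)
  have hξp : 0 < |ξ| ^ ((5 : ℝ) / 2) := Real.rpow_pos_of_pos hξ _
  have hηp : 0 < |η| ^ ((5 : ℝ) / 2) := Real.rpow_pos_of_pos hη _
  rw [habs]
  intro h0
  rcases hε₁ with rfl | rfl <;> rcases hε₂ with rfl | rfl <;> linarith
end

section
/- Conservation of the linearized energy: let w, r : ℝ → 𝒮(ℝ; ℂ) be continuously differentiable curves with values in the Schwartz space, satisfying for all (t,α) the linearized hydroelastic system ∂ₜw(t,α) = −∂_α r(t,α) and ∂ₜr(t,α) = i ∂_α⁴ w(t,α). Then the energy 𝓔₀(t) := ∫_ℝ ( −i · ∂_α w(t,α) · conj(∂_α² w(t,α)) + |r(t,α)|² ) dα is independent of t. -/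
open Filter Topology MeasureTheory ComplexConjugate

/-- A curve of Schwartz functions which is pointwise differentiable with a derivative that is
continuous in the Schwartz topology is differentiable as a curve in `L^p`. -/
theorem SchwartzMap.hasDerivAt_toLp_of_pointwise {u u' : ℝ → SchwartzMap ℝ ℂ}
    (p : ENNReal) [Fact (1 ≤ p)] (hu' : Continuous u')
    (hu : ∀ t x : ℝ, HasDerivAt (fun s => u s x) (u' t x) t) (t : ℝ) :
    HasDerivAt (fun s => (u s).toLp p volume) ((u' t).toLp p volume) t := by
  obtain ⟨k, C, hC, hbound⟩ := SchwartzMap.norm_toLp_le_seminorm ℝ ℂ p (volume : Measure ℝ)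
  set q := (Finset.Iic (k, 0)).sup (schwartzSeminormFamily ℝ ℝ ℂ)
  have hq_cont : Continuous q :=
    Seminorm.continuous_finsetSup fun i _ =>
      (schwartz_withSeminorms ℝ ℝ ℂ).continuous_seminorm i
  rw [hasDerivAt_iff_isLittleO, Asymptotics.isLittleO_iff]
  intro ε hε
  have hη : 0 < ε / (C + 1) := by positivity
  have htends : Tendsto (fun s => q (u' s - u' t)) (𝓝 t) (𝓝 0) := by
    have : Continuous fun s => q (u' s - u' t) := hq_cont.comp (hu'.sub continuous_const)
    simpa using this.tendsto t
  obtain ⟨δ, hδ, hball⟩ := Metric.eventually_nhds_iff_ball.1 (htends.eventually_lt_const hη)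
  filter_upwards [Metric.ball_mem_nhds t hδ] with s hs
  have hq_le : q (u s - u t - (s - t) • u' t) ≤ ε / (C + 1) * ‖s - t‖ := by
    refine Seminorm.finset_sup_apply_le (by positivity) ?_
    rintro ⟨i, j⟩ hij
    obtain ⟨-, rfl⟩ : i ≤ k ∧ j = 0 := by simpa [Prod.le_def] using hij
    refine SchwartzMap.seminorm_le_bound ℝ i 0 _ (by positivity) fun x => ?_
    have hd : ∀ σ ∈ Metric.ball t δ,
        HasDerivWithinAt (fun σ : ℝ => ‖x‖ ^ i • (u σ x - σ • u' t x))
          (‖x‖ ^ i • (u' σ x - u' t x)) (Metric.ball t δ) σ := fun σ _ => by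
      simpa only [one_smul] using! (((hu σ x).sub ((hasDerivAt_id σ).smul_const
        (u' t x))).const_smul (‖x‖ ^ i)).hasDerivWithinAt
    have hb : ∀ σ ∈ Metric.ball t δ, ‖‖x‖ ^ i • (u' σ x - u' t x)‖ ≤ ε / (C + 1) := by
      intro σ hσ
      have h₁ := SchwartzMap.norm_pow_mul_le_seminorm ℝ (u' σ - u' t) i x
      have h₂ : schwartzSeminormFamily ℝ ℝ ℂ (i, 0) ≤ q := Finset.le_sup hij
      have h₃ := (h₁.trans (h₂ (u' σ - u' t))).trans (hball σ hσ).le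
      simpa [norm_smul] using h₃
    have hmv := Convex.norm_image_sub_le_of_norm_hasDerivWithin_le hd hb (convex_ball t δ)
      (Metric.mem_ball_self hδ) hs
    rw [← smul_sub, norm_smul, norm_pow, norm_norm] at hmv
    rw [norm_iteratedFDeriv_zero]
    convert hmv using 3
    simp only [_root_.sub_apply, _root_.smul_apply, sub_smul]
    abel
  have hsplit : (u s).toLp p volume - (u t).toLp p volume - (s - t) • (u' t).toLp p volume
      = (u s - u t - (s - t) • u' t).toLp p volume := by
    simp only [← SchwartzMap.toLpCLM_apply (𝕜 := ℝ), map_sub, map_smul]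
  rw [hsplit]
  calc _ ≤ C * q (u s - u t - (s - t) • u' t) := hbound _
    _ ≤ C * (ε / (C + 1) * ‖s - t‖) := by gcongr
    _ = C / (C + 1) * (ε * ‖s - t‖) := by ring
    _ ≤ 1 * (ε * ‖s - t‖) := by
      gcongr
      exact (div_le_one (by positivity)).2 (by linarith)
    _ = _ := one_mul _

/-- The derivative of `t ↦ ⟪V t, W t⟫` when `V` is merely continuous, but is related to `W`
like the image of `W` under a skew-symmetric operator. -/
theorem hasDerivAt_inner_of_skew {E : Type*} [NormedAddCommGroup E] [InnerProductSpace ℂ E]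
    [NormedSpace ℝ E] [IsScalarTower ℝ ℂ E] {V W : ℝ → E} {W' : E} {t : ℝ}
    (hV : ContinuousAt V t) (hW : HasDerivAt W W' t)
    (hskew : ∀ s τ, inner ℂ (V s) (W τ) = -inner ℂ (W s) (V τ)) :
    HasDerivAt (fun s => inner ℂ (V s) (W s)) (inner ℂ (V t) W' - inner ℂ W' (V t)) t := by
  rw [hasDerivAt_iff_tendsto_slope] at hW ⊢
  have hV' : Tendsto V (𝓝[≠] t) (𝓝 (V t)) := hV.tendsto.mono_left nhdsWithin_le_nhds
  refine ((hV'.inner (𝕜 := ℂ) hW).sub (hW.inner (𝕜 := ℂ) tendsto_const_nhds)).congr fun s => ?_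
  have hr : ∀ (c : ℝ) (x : E), c • x = (c : ℂ) • x := fun c x => (algebraMap_smul ℂ c x).symm
  simp only [slope_def_module, hr, inner_smul_left, inner_smul_right, inner_sub_left,
    inner_sub_right, Complex.conj_ofReal, Complex.real_smul]
  rw [hskew s t, hskew t t]
  ring

/-- Differentiation of Schwartz functions is skew-symmetric in `L²`. -/
theorem SchwartzMap.inner_toLp_derivCLM (f g : SchwartzMap ℝ ℂ) :
    inner ℂ ((SchwartzMap.derivCLM ℂ ℂ f).toLp 2 volume) (g.toLp 2 volume)
      = -inner ℂ (f.toLp 2 volume) ((SchwartzMap.derivCLM ℂ ℂ g).toLp 2 volume) := by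
  rw [SchwartzMap.inner_toL2_toL2_eq _ _ volume, SchwartzMap.inner_toL2_toL2_eq _ _ volume]
  have h := SchwartzMap.integral_mul_deriv_eq_neg_deriv_mul
    (f.postcompCLM (Complex.conjCLE : ℂ →L[ℝ] ℂ)) g
  have hconj : ∀ x, deriv (f.postcompCLM (Complex.conjCLE : ℂ →L[ℝ] ℂ)) x = conj (deriv f x) :=
    fun x => ((Complex.conjCLE : ℂ →L[ℝ] ℂ).hasFDerivAt.comp_hasDerivAt x (f.hasDerivAt x)).deriv
  simp only [hconj, SchwartzMap.postcompCLM_apply] at h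
  simp only [RCLike.inner_apply', SchwartzMap.derivCLM_apply]
  exact (neg_eq_iff_eq_neg.2 h).symm

/-- The iterated derivative of a Schwartz function as an iterate of `SchwartzMap.derivCLM`. -/
theorem SchwartzMap.iteratedDeriv_eq_derivCLM_iterate (n : ℕ) (f : SchwartzMap ℝ ℂ) :
    iteratedDeriv n f = ((SchwartzMap.derivCLM ℂ ℂ)^[n] f : SchwartzMap ℝ ℂ) := by
  induction n with
  | zero => simp
  | succ n ih =>
    rw [iteratedDeriv_succ, ih, Function.iterate_succ_apply']
    rfl

/-- The linearized energy in terms of `L²` inner products. -/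
theorem linearized_energy_eq_inner (f g : SchwartzMap ℝ ℂ) :
    (∫ α : ℝ, (-Complex.I * deriv (⇑f) α * conj (iteratedDeriv 2 (⇑f) α)
        + ((‖g α‖ ^ 2 : ℝ) : ℂ)))
      = Complex.I * inner ℂ (((SchwartzMap.derivCLM ℂ ℂ)^[3] f).toLp 2 volume)
          (f.toLp 2 volume)
        + inner ℂ (g.toLp 2 volume) (g.toLp 2 volume) := by
  have hD : inner ℂ (((SchwartzMap.derivCLM ℂ ℂ)^[3] f).toLp 2 volume) (f.toLp 2 volume)
      = -inner ℂ (((SchwartzMap.derivCLM ℂ ℂ)^[2] f).toLp 2 volume)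
        ((SchwartzMap.derivCLM ℂ ℂ f).toLp 2 volume) := by
    rw [Function.iterate_succ_apply', SchwartzMap.inner_toLp_derivCLM]
  have hint : ∀ a b : SchwartzMap ℝ ℂ, Integrable fun x => inner ℂ (a x) (b x) := fun a b => by
    refine (L2.integrable_inner (𝕜 := ℂ) (a.toLp 2 volume) (b.toLp 2 volume)).congr ?_
    filter_upwards [a.coeFn_toLp 2 volume, b.coeFn_toLp 2 volume] with x ha hb
    rw [ha, hb]
  rw [hD, SchwartzMap.inner_toL2_toL2_eq _ _ volume, SchwartzMap.inner_toL2_toL2_eq _ _ volume,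
    mul_neg, ← neg_mul, ← integral_const_mul, ← integral_add ((hint _ _).const_mul _) (hint _ _)]
  refine integral_congr_ae (Eventually.of_forall fun x => ?_)
  simp only [SchwartzMap.iteratedDeriv_eq_derivCLM_iterate, RCLike.inner_apply,
    SchwartzMap.derivCLM_apply, Complex.mul_conj']
  push_cast
  ring

/-- Conservation of the linearized energy: if `w, r : ℝ → 𝒮(ℝ, ℂ)` are continuously
differentiable curves of Schwartz functions solving the linearized hydroelastic system
`∂ₜw = −∂_α r`, `∂ₜr = i ∂_α⁴ w`, then the energy
`𝓔₀(t) = ∫ (−i · w_α · conj(w_{αα}) + |r|²) dα` is independent of `t`. -/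
theorem linearized_energy_conserved (w r w' r' : ℝ → SchwartzMap ℝ ℂ)
    (hw_cont : Continuous w) (hr_cont : Continuous r)
    (hw'_cont : Continuous w') (hr'_cont : Continuous r')
    (hw_deriv : ∀ t α : ℝ, HasDerivAt (fun s => w s α) (w' t α) t)
    (hr_deriv : ∀ t α : ℝ, HasDerivAt (fun s => r s α) (r' t α) t)
    (heq_w : ∀ t α : ℝ, w' t α = - deriv (⇑(r t)) α)
    (heq_r : ∀ t α : ℝ, r' t α = Complex.I * iteratedDeriv 4 (⇑(w t)) α) :
    ∀ t₁ t₂ : ℝ,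
      (∫ α : ℝ, (-Complex.I * deriv (⇑(w t₁)) α * conj (iteratedDeriv 2 (⇑(w t₁)) α)
          + ((‖r t₁ α‖ ^ 2 : ℝ) : ℂ)))
        = ∫ α : ℝ, (-Complex.I * deriv (⇑(w t₂)) α * conj (iteratedDeriv 2 (⇑(w t₂)) α)
          + ((‖r t₂ α‖ ^ 2 : ℝ) : ℂ)) := by
  set D := SchwartzMap.derivCLM ℂ ℂ
  have hw' : ∀ t, w' t = -D (r t) := fun t => by
    ext α
    simpa [D] using heq_w t α
  have hr' : ∀ t, r' t = Complex.I • D^[4] (w t) := fun t => by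
    ext α
    rw [heq_r, SchwartzMap.iteratedDeriv_eq_derivCLM_iterate]
    rfl
  have hskew : ∀ f g : SchwartzMap ℝ ℂ,
      inner ℂ ((D^[3] f).toLp 2 volume) (g.toLp 2 volume)
        = -inner ℂ (f.toLp 2 volume) ((D^[3] g).toLp 2 volume) := fun f g => by
    simp only [Function.iterate_succ_apply', Function.iterate_zero, id_eq, D,
      SchwartzMap.inner_toLp_derivCLM, neg_neg]
  have hV : Continuous fun t => (D^[3] (w t)).toLp 2 volume :=
    SchwartzMap.continuous_toLp.comp ((D.continuous.iterate 3).comp hw_cont)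
  have hW := SchwartzMap.hasDerivAt_toLp_of_pointwise 2 hw'_cont hw_deriv
  have hR := SchwartzMap.hasDerivAt_toLp_of_pointwise 2 hr'_cont hr_deriv
  have hderiv : ∀ t, HasDerivAt (fun s => Complex.I *
      inner ℂ ((D^[3] (w s)).toLp 2 volume) ((w s).toLp 2 volume)
        + inner ℂ ((r s).toLp 2 volume) ((r s).toLp 2 volume)) 0 t := fun t => by
    refine (((hasDerivAt_inner_of_skew hV.continuousAt (hW t) fun s τ => hskew (w s) (w τ)).const_mul
      Complex.I).add ((hR t).inner ℂ (hR t))).congr_deriv ?_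
    have h₁ : (w' t).toLp 2 volume = -(D (r t)).toLp 2 volume := by
      simp only [hw', ← SchwartzMap.toLpCLM_apply (𝕜 := ℂ), map_neg]
    have h₂ : (r' t).toLp 2 volume = Complex.I • (D^[4] (w t)).toLp 2 volume := by
      simp only [hr', ← SchwartzMap.toLpCLM_apply (𝕜 := ℂ), map_smul]
    have h₃ : inner ℂ ((D^[4] (w t)).toLp 2 volume) ((r t).toLp 2 volume)
        = -inner ℂ ((D^[3] (w t)).toLp 2 volume) ((D (r t)).toLp 2 volume) := by
      rw [Function.iterate_succ_apply', SchwartzMap.inner_toLp_derivCLM]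
    have h₄ : inner ℂ ((D (r t)).toLp 2 volume) ((D^[3] (w t)).toLp 2 volume)
        = -inner ℂ ((r t).toLp 2 volume) ((D^[4] (w t)).toLp 2 volume) := by
      rw [Function.iterate_succ_apply' D 3, SchwartzMap.inner_toLp_derivCLM]
    rw [h₁, h₂, inner_neg_left, inner_neg_right, inner_smul_left, inner_smul_right, h₃, h₄,
      Complex.conj_I]
    ring
  intro t₁ t₂
  rw [linearized_energy_eq_inner, linearized_energy_eq_inner]
  exact is_const_of_deriv_eq_zero (fun t => (hderiv t).differentiableAt)
    (fun t => (hderiv t).deriv) t₁ t₂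
end

section
/- Solvability of the cubic energy correction symbol system: for all real numbers ξ and η with η ≠ 0, setting ζ := ξ + η, there exist real numbers a, b, c, d such that: (1) ζ⁴·a − η⁴·b + ξ·c = (7/2)ξηζ² + (5/4)ξ²ζ² + (3/4)ξ³ζ; (2) ξ⁴·b − η·c − ζ⁴·d = −3ξζ³ + (9/2)ξ²ζ² − 3ξ³ζ; (3) ξ⁴·a + ζ·c + η⁴·d = 3ξη³ + (15/2)ξ²η² + 5ξ³η + 2ξ⁴; (4) η·a − ζ·b + ξ·d = (3/2)ξ. -/
/-- The common denominator of the cubic correction symbols. -/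
def correctionDenominator (ξ η : ℝ) : ℝ :=
  25 * ξ ^ 6 + 100 * ξ ^ 5 * η + 200 * ξ ^ 4 * η ^ 2 + 246 * ξ ^ 3 * η ^ 3
    + 200 * ξ ^ 2 * η ^ 4 + 100 * ξ * η ^ 5 + 25 * η ^ 6

theorem correctionDenominator_eq (ξ η : ℝ) :
    correctionDenominator ξ η =
      (ξ ^ 2 + η ^ 2) * (25 * (ξ + η) ^ 4 + 2 * (ξ * η) ^ 2) + 23 * (ξ * η * (ξ + η)) ^ 2 := by
  unfold correctionDenominator
  ring

theorem correctionDenominator_pos (ξ : ℝ) {η : ℝ} (hη : η ≠ 0) :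
    0 < correctionDenominator ξ η := by
  rw [correctionDenominator_eq]
  rcases eq_or_ne ξ 0 with rfl | hξ
  · simp only [zero_add]
    positivity
  · positivity


/-- Solvability of the 4×4 algebraic linear system for the symbols `𝔞, 𝔟, 𝔠, 𝔡` of the
paradifferential cubic forms in the cubic energy correction `E³_cor`, with `ζ = ξ + η`. -/
theorem cubic_correction_symbols_solvable (ξ η : ℝ) (hη : η ≠ 0) :
    ∃ a b c d : ℝ,
      (ξ + η) ^ 4 * a - η ^ 4 * b + ξ * c
          = (7 / 2) * ξ * η * (ξ + η) ^ 2 + (5 / 4) * ξ ^ 2 * (ξ + η) ^ 2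
            + (3 / 4) * ξ ^ 3 * (ξ + η) ∧
      ξ ^ 4 * b - η * c - (ξ + η) ^ 4 * d
          = -3 * ξ * (ξ + η) ^ 3 + (9 / 2) * ξ ^ 2 * (ξ + η) ^ 2 - 3 * ξ ^ 3 * (ξ + η) ∧
      ξ ^ 4 * a + (ξ + η) * c + η ^ 4 * d
          = 3 * ξ * η ^ 3 + (15 / 2) * ξ ^ 2 * η ^ 2 + 5 * ξ ^ 3 * η + 2 * ξ ^ 4 ∧
      η * a - (ξ + η) * b + ξ * d = (3 / 2) * ξ := by
  have hD := (correctionDenominator_pos ξ hη).ne'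
  refine ⟨(75 * ξ ^ 6 + 300 * ξ ^ 5 * η + 625 * ξ ^ 4 * η ^ 2 + 785 * ξ ^ 3 * η ^ 3
        + 600 * ξ ^ 2 * η ^ 4 + 255 * ξ * η ^ 5 + 40 * η ^ 6)
        / (4 * correctionDenominator ξ η),
    (-70 * ξ ^ 6 - 245 * ξ ^ 5 * η - 385 * ξ ^ 4 * η ^ 2 - 300 * ξ ^ 3 * η ^ 3
        - 65 * ξ ^ 2 * η ^ 4 + 65 * ξ * η ^ 5 + 40 * η ^ 6)
        / (4 * correctionDenominator ξ η),
    (125 * ξ ^ 9 + 875 * ξ ^ 8 * η + 2850 * ξ ^ 7 * η ^ 2 + 5633 * ξ ^ 6 * η ^ 3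
        + 7407 * ξ ^ 5 * η ^ 4 + 6708 * ξ ^ 4 * η ^ 5 + 4134 * ξ ^ 3 * η ^ 6
        + 1600 * ξ ^ 2 * η ^ 7 + 300 * ξ * η ^ 8) / (4 * correctionDenominator ξ η),
    (40 * ξ ^ 6 + 105 * ξ ^ 5 * η + 135 * ξ ^ 4 * η ^ 2 + 83 * ξ ^ 3 * η ^ 3
        + 25 * ξ ^ 2 * η ^ 4) / (2 * correctionDenominator ξ η), ?_, ?_, ?_, ?_⟩ <;>
  · field_simp
    unfold correctionDenominator
    ring
end

section
/- Solvability of the low-high quadratic normal form symbol system for the source terms (𝒫𝒢₀, 𝒫𝒦₀): for all real numbers η and ζ with (η,ζ) ≠ (0,0), there exist real numbers a, b, c, d such that: (1) (ζ−η)·a + η·b + ζ⁴·c = −η; (2) ζ·b + η⁴·c − (ζ−η)·d = −η; (3) ζ·a + (ζ−η)⁴·c − η·d = η; (4) η⁴·a + (ζ−η)⁴·b − ζ⁴·d = (3/2)η⁴ − η³ζ − η²ζ² + (3/2)ηζ³. -/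
/-- The common denominator of the low-high normal form symbols is positive away from the origin. -/
theorem lowhigh_denominator_pos {η ζ : ℝ} (h : (η, ζ) ≠ (0, 0)) :
    0 < 4 * η ^ 6 - 12 * η ^ 5 * ζ + 37 * η ^ 4 * ζ ^ 2 - 54 * η ^ 3 * ζ ^ 3
      + 75 * η ^ 2 * ζ ^ 4 - 50 * η * ζ ^ 5 + 25 * ζ ^ 6 := by
  have key : 4 * η ^ 6 - 12 * η ^ 5 * ζ + 37 * η ^ 4 * ζ ^ 2 - 54 * η ^ 3 * ζ ^ 3
      + 75 * η ^ 2 * ζ ^ 4 - 50 * η * ζ ^ 5 + 25 * ζ ^ 6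
      = (2 * η ^ 3 - 3 * η ^ 2 * ζ + 5 * η * ζ ^ 2 - 5 * ζ ^ 3) ^ 2
        + (η * ζ) ^ 2 * (4 * η ^ 2 + (2 * η - ζ) ^ 2 + 19 * ζ ^ 2) := by ring
  rw [key]
  by_cases hη : η = 0
  · have hζ : ζ ≠ 0 := fun hζ => h (by rw [hη, hζ])
    subst hη
    ring_nf
    positivity
  by_cases hζ : ζ = 0
  · subst hζ
    ring_nf
    positivity
  positivity

/-- Solvability of the 4×4 algebraic linear system for the low-high quadratic normal form
symbols `𝔞⁰_lh, 𝔟⁰_lh, 𝔠⁰_lh, 𝔡⁰_lh` eliminating the source terms `(𝒫𝒢₀, 𝒫𝒦₀)`. -/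
theorem lowhigh_normal_form_symbols_solvable (η ζ : ℝ) (h : (η, ζ) ≠ (0, 0)) :
    ∃ a b c d : ℝ,
      (ζ - η) * a + η * b + ζ ^ 4 * c = -η ∧
      ζ * b + η ^ 4 * c - (ζ - η) * d = -η ∧
      ζ * a + (ζ - η) ^ 4 * c - η * d = η ∧
      η ^ 4 * a + (ζ - η) ^ 4 * b - ζ ^ 4 * d
        = (3 / 2) * η ^ 4 - η ^ 3 * ζ - η ^ 2 * ζ ^ 2 + (3 / 2) * η * ζ ^ 3 := by
  have hD := (lowhigh_denominator_pos h).ne'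
  set D := 4 * η ^ 6 - 12 * η ^ 5 * ζ + 37 * η ^ 4 * ζ ^ 2 - 54 * η ^ 3 * ζ ^ 3
      + 75 * η ^ 2 * ζ ^ 4 - 50 * η * ζ ^ 5 + 25 * ζ ^ 6 with hDdef
  refine ⟨
    (5 * ζ ^ 6 - 25 / 2 * η * ζ ^ 5 + 30 * η ^ 2 * ζ ^ 4 - 65 / 2 * η ^ 3 * ζ ^ 3
      + 30 * η ^ 4 * ζ ^ 2 - 25 / 2 * η ^ 5 * ζ + 5 * η ^ 6) / D,
    (-(25 / 2) * ζ ^ 6 + 25 / 2 * η * ζ ^ 5 - 25 / 2 * η ^ 2 * ζ ^ 4 - 17 / 2 * η ^ 3 * ζ ^ 3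
      + 11 / 2 * η ^ 4 * ζ ^ 2 - 11 / 2 * η ^ 5 * ζ + η ^ 6) / D,
    (-5 * ζ ^ 3 + 5 * η * ζ ^ 2 - 5 * η ^ 2 * ζ) / D,
    (-(25 / 2) * ζ ^ 6 + 25 * η * ζ ^ 5 - 75 / 2 * η ^ 2 * ζ ^ 4 + 29 * η ^ 3 * ζ ^ 3
      - 49 / 2 * η ^ 4 * ζ ^ 2 + 12 * η ^ 5 * ζ - 4 * η ^ 6) / D, ?_, ?_, ?_, ?_⟩ <;>
  · field_simp
    rw [hDdef]
    ring
end

section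
/- Solvability of the mixed-type balanced normal form symbol system for the full hydroelastic waves: for all real numbers η and ζ with η ≠ 0, there exist real numbers a, b, c, d such that: (1) (ζ−η)·a − ζ·b − η⁴·c = ζ−η; (2) η·b + ζ⁴·c + (ζ−η)·d = ζ−η; (3) η·a − (ζ−η)⁴·c − ζ·d = ζ−η; (4) ζ⁴·a − (ζ−η)⁴·b − η⁴·d = (3/2)ζ⁴ − (5/2)ζ³η + (5/2)ζη³ − (3/2)η⁴. -/
/-- The dehomogenized denominator `D̃(1, z)` is positive. -/
lemma balanced_denominator_pos (z : ℝ) :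
    0 < 25 * z ^ 6 - 50 * z ^ 5 + 75 * z ^ 4 - 54 * z ^ 3 + 37 * z ^ 2 - 12 * z + 4 := by
  have h : 25 * z ^ 6 - 50 * z ^ 5 + 75 * z ^ 4 - 54 * z ^ 3 + 37 * z ^ 2 - 12 * z + 4
      = (5 * z ^ 3 - 5 * z ^ 2 + 4 * z - 1) ^ 2 + z ^ 2 * ((2 * z - 1) ^ 2 + 6 * z ^ 2)
        + ((2 * z - 1) ^ 2 + 6 * z ^ 2 + 2) := by ring
  rw [h]
  positivity

/-- After eliminating `a` and `b` from the system with `η = 1` and dividing by `z - 1`, a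
`2 × 2` system for `c` and `d` remains, whose determinant is `D̃(1, z)`. -/
lemma exists_reduced_balanced_symbols (z : ℝ) :
    ∃ c d : ℝ,
      (2 * z ^ 4 - 3 * z ^ 3 + 7 * z ^ 2 - 3 * z + 2) * c + 2 * z * d = 2 ∧
      2 * z ^ 4 * (z - 1) ^ 3 * c + (2 * z ^ 4 - 3 * z ^ 3 + 7 * z ^ 2 - 3 * z + 2) * d
        = (3 / 2) * z ^ 3 - z ^ 2 - z + 3 / 2 - z ^ 4 + (z - 1) ^ 4 := by
  have hD := (balanced_denominator_pos z).ne'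
  set D := 25 * z ^ 6 - 50 * z ^ 5 + 75 * z ^ 4 - 54 * z ^ 3 + 37 * z ^ 2 - 12 * z + 4 with hDdef
  set P := 2 * z ^ 4 - 3 * z ^ 3 + 7 * z ^ 2 - 3 * z + 2 with hP
  set T := (3 / 2) * z ^ 3 - z ^ 2 - z + 3 / 2 - z ^ 4 + (z - 1) ^ 4
  have hdet : P ^ 2 - 4 * z ^ 5 * (z - 1) ^ 3 = D := by rw [hP, hDdef]; ring
  refine ⟨(2 * P - 2 * z * T) / D, (P * T - 4 * z ^ 4 * (z - 1) ^ 3) / D, ?_, ?_⟩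
  · field_simp
    linear_combination 2 * hdet
  · field_simp
    linear_combination T * hdet

/-- Solvability of the 4×4 algebraic linear system for the mixed-type balanced normal form
symbols `𝔞^a_bal, 𝔟^a_bal, 𝔠^a_bal, 𝔡^a_bal` for the full hydroelastic waves. -/
theorem mixed_balanced_symbols_solvable (η ζ : ℝ) (hη : η ≠ 0) :
    ∃ a b c d : ℝ,
      (ζ - η) * a - ζ * b - η ^ 4 * c = ζ - η ∧
      η * b + ζ ^ 4 * c + (ζ - η) * d = ζ - η ∧
      η * a - (ζ - η) ^ 4 * c - ζ * d = ζ - η ∧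
      ζ ^ 4 * a - (ζ - η) ^ 4 * b - η ^ 4 * d
        = (3 / 2) * ζ ^ 4 - (5 / 2) * ζ ^ 3 * η + (5 / 2) * ζ * η ^ 3 - (3 / 2) * η ^ 4 := by
  obtain ⟨z, rfl⟩ : ∃ z, ζ = η * z := ⟨ζ / η, by field_simp⟩
  obtain ⟨c, d, h₁, h₂⟩ := exists_reduced_balanced_symbols z
  -- By homogeneity, `a, b, d` have degree `0` and `c` has degree `-3` in `(η, ζ)`.
  refine ⟨z - 1 + (z - 1) ^ 4 * c + z * d, z - 1 - z ^ 4 * c - (z - 1) * d, c / η ^ 3, d,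
    ?_, ?_, ?_, ?_⟩
  · field_simp
    linear_combination (z - 1) * h₁
  · field_simp
    ring
  · field_simp
    ring
  · linear_combination η ^ 4 * (z - 1) * h₂
end
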